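/- Let n ≥ 1, 0 < b < 1/2, Φ ∈ 𝒮(ℝⁿ)∖{0}, let K, V ⊂ ℝⁿ be compact, and let K̃, Ṽ ⊂ ℝⁿ be open sets with K ⊂ K̃ and V ⊂ Ṽ. Then there exists λ₀ ≥ 1 such that for every measurable h : ℝ²ⁿ → [0,∞], every λ ≥ λ₀ and every c ∈ ℝ, ‖ ∬_{|w| ≤ λ^{−b/2}, |η| ≤ λ^{3b/2}} W_Φ Φ(λ^b w, λ^{−b} η)| in absolute value times h( x − w + c(λξ − η), λξ − η ) dw dη ‖_{L²_x(K) × L²_ξ(V)} ≤ ‖W_Φ Φ‖_{L¹(ℝ²ⁿ)} · ‖ h( x + cλξ, λξ ) ‖_{L²_x(K̃) × L²_ξ(Ṽ)}; i.e. the contribution of the region |w| ≤ λ^{−b/2}, |η| ≤ λ^{3b/2} to the convolution is controlled by the norm of h( x + cλξ, λξ ) over the slightly enlarged sets K̃, Ṽ. -/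

import Mathlib

open MeasureTheory Complex Real
open scoped InnerProductSpace ENNReal

/-- The wave packet transform of `f` with window function `φ`:
`W_φ f (x, ξ) = ∫ conj (φ (y - x)) * f y * exp (- i ⟨y, ξ⟩) dy`. -/
noncomputable def wavePacket {n : ℕ} (φ f : EuclideanSpace ℝ (Fin n) → ℂ)
    (x ξ : EuclideanSpace ℝ (Fin n)) : ℂ :=
  ∫ y, (starRingEnd ℂ) (φ (y - x)) * f y * Complex.exp (-(Complex.I * (⟪y, ξ⟫_ℝ : ℂ)))

open scoped SchwartzMap FourierTransform

section SchwartzDecay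

variable {E : Type*} [NormedAddCommGroup E] [InnerProductSpace ℝ E]

lemma SchwartzMap.exists_one_add_norm_pow_mul_norm_iteratedFDeriv_le (f : 𝓢(E, ℂ)) (k N : ℕ) :
    ∃ C : ℝ, 0 ≤ C ∧ ∀ i ≤ N, ∀ x, (1 + ‖x‖) ^ k * ‖iteratedFDeriv ℝ i f x‖ ≤ C :=
  ⟨2 ^ k * ((Finset.Iic (k, N)).sup fun m => SchwartzMap.seminorm ℂ m.1 m.2) f, by positivity,
    fun _ hi x => SchwartzMap.one_add_le_sup_seminorm_apply (m := (k, N)) le_rfl hi f x⟩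

/-- Derivatives of `f (· - x) * g` decay jointly in the translation and in the variable. -/
lemma SchwartzMap.exists_norm_iteratedFDeriv_translate_mul_le (f g : 𝓢(E, ℂ)) (k N : ℕ) :
    ∃ C : ℝ, 0 ≤ C ∧ ∀ j ≤ N, ∀ x v, (1 + ‖x‖) ^ k * ((1 + ‖v‖) ^ k *
      ‖iteratedFDeriv ℝ j (fun y => f (y - x) * g y) v‖) ≤ C := by
  obtain ⟨A, hA0, hA⟩ := f.exists_one_add_norm_pow_mul_norm_iteratedFDeriv_le k N
  obtain ⟨B, hB0, hB⟩ := g.exists_one_add_norm_pow_mul_norm_iteratedFDeriv_le (k + k) N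
  refine ⟨2 ^ N * (A * B), by positivity, fun j hj x v => ?_⟩
  have hf : ContDiff ℝ j (fun y => f (y - x)) := (f.smooth j).comp (by fun_prop)
  have hx : (1 + ‖x‖) ^ k ≤ (1 + ‖v - x‖) ^ k * (1 + ‖v‖) ^ k := by
    rw [← mul_pow]
    gcongr
    have : ‖x‖ ≤ ‖v‖ + ‖v - x‖ := by simpa using norm_sub_le v (v - x)
    nlinarith [norm_nonneg v, norm_nonneg (v - x)]
  calc _ ≤ ((1 + ‖v - x‖) ^ k * (1 + ‖v‖) ^ k) * ((1 + ‖v‖) ^ k *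
        ∑ i ∈ Finset.range (j + 1), (j.choose i : ℝ) * ‖iteratedFDeriv ℝ i f (v - x)‖ *
          ‖iteratedFDeriv ℝ (j - i) g v‖) := by
        gcongr
        refine (norm_iteratedFDeriv_mul_le hf (g.smooth j) v le_rfl).trans_eq ?_
        simp only [iteratedFDeriv_comp_sub]
    _ = ∑ i ∈ Finset.range (j + 1), (j.choose i : ℝ) *
          (((1 + ‖v - x‖) ^ k * ‖iteratedFDeriv ℝ i f (v - x)‖) *
          ((1 + ‖v‖) ^ (k + k) * ‖iteratedFDeriv ℝ (j - i) g v‖)) := by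
        simp only [Finset.mul_sum, pow_add]
        exact Finset.sum_congr rfl fun i _ => by ring
    _ ≤ ∑ i ∈ Finset.range (j + 1), (j.choose i : ℝ) * (A * B) := by
        gcongr with i hi
        · exact hA i (by grind) _
        · exact hB _ (by omega) _
    _ = 2 ^ j * (A * B) := by
        rw [← Finset.sum_mul]
        exact_mod_cast congrArg (fun t : ℕ => (t : ℝ) * (A * B)) (Nat.sum_range_choose j)
    _ ≤ 2 ^ N * (A * B) := by
        gcongr
        norm_num

/-- The function `y ↦ conj (φ (y - x)) * f y` whose Fourier transform is the wave packet
transform at position `x`. -/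
noncomputable def SchwartzMap.windowed (φ f : 𝓢(E, ℂ)) (x : E) : 𝓢(E, ℂ) :=
  SchwartzMap.pairing (ContinuousLinearMap.mul ℝ ℂ)
    (SchwartzMap.compSubConstCLM ℝ x
      (SchwartzMap.postcompCLM (Complex.conjCLE : ℂ →L[ℝ] ℂ) φ)) f

lemma SchwartzMap.windowed_apply (φ f : 𝓢(E, ℂ)) (x y : E) :
    φ.windowed f x y = (starRingEnd ℂ) (φ (y - x)) * f y := by
  simp [SchwartzMap.windowed]

variable [FiniteDimensional ℝ E] [MeasurableSpace E] [BorelSpace E]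

lemma SchwartzMap.norm_pow_mul_norm_fourier_le (f : 𝓢(E, ℂ)) (N : ℕ) {r : ℝ}
    (hr : (Module.finrank ℝ E : ℝ) < r) {C : ℝ}
    (hC : ∀ j ≤ N, ∀ v, ‖iteratedFDeriv ℝ j f v‖ ≤ C * (1 + ‖v‖) ^ (-r)) (ξ : E) :
    ‖ξ‖ ^ N * ‖𝓕 (f : E → ℂ) ξ‖ ≤ 2 ^ N * ((N + 1) * (C * ∫ v : E, (1 + ‖v‖) ^ (-r))) := by
  have h := Real.pow_mul_norm_iteratedFDeriv_fourier_le (K := 0) (N := N) (k := 0) (n := N)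
    (f.smooth N) (fun k n _ _ => f.integrable_pow_mul_iteratedFDeriv volume k n) le_rfl le_rfl ξ
  simp only [norm_iteratedFDeriv_zero, pow_zero, one_mul, CharP.cast_eq_zero, mul_zero, zero_add,
    Finset.range_one, Finset.sum_product, Finset.sum_singleton] at h
  refine h.trans ?_
  gcongr
  calc _ ≤ ∑ _j ∈ Finset.range (N + 1), C * ∫ v : E, (1 + ‖v‖) ^ (-r) := by
        refine Finset.sum_le_sum fun j hj => ?_
        rw [← integral_const_mul]
        refine integral_mono ?_ ((integrable_one_add_norm hr).const_mul C)
          (hC j (by grind))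
        simpa using f.integrable_pow_mul_iteratedFDeriv volume 0 j
    _ = _ := by simp

lemma SchwartzMap.exists_norm_fourier_windowed_le (φ f : 𝓢(E, ℂ)) {m : ℕ}
    (hm : Module.finrank ℝ E < m) :
    ∃ C : ℝ, ∀ x ξ, ‖𝓕 (φ.windowed f x : E → ℂ) ξ‖ ≤
      C * ((1 + ‖x‖) ^ (-(m : ℝ)) * (1 + ‖ξ‖) ^ (-(m : ℝ))) := by
  obtain ⟨C, hC0, hC⟩ := SchwartzMap.exists_norm_iteratedFDeriv_translate_mul_le
    (SchwartzMap.postcompCLM (Complex.conjCLE : ℂ →L[ℝ] ℂ) φ) f m m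
  have hdec (x : E) : ∀ j ≤ m, ∀ v, ‖iteratedFDeriv ℝ j (φ.windowed f x) v‖ ≤
      C * (1 + ‖x‖) ^ (-(m : ℝ)) * (1 + ‖v‖) ^ (-(m : ℝ)) := by
    intro j hj v
    have h := hC j hj x v
    have e : (φ.windowed f x : E → ℂ) = fun y =>
        SchwartzMap.postcompCLM (Complex.conjCLE : ℂ →L[ℝ] ℂ) φ (y - x) * f y := by
      ext y
      simp [SchwartzMap.windowed_apply]
    rw [← e] at h
    rw [Real.rpow_neg (by positivity), Real.rpow_neg (by positivity), Real.rpow_natCast,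
      Real.rpow_natCast, ← div_eq_mul_inv, ← div_eq_mul_inv, le_div_iff₀ (by positivity),
      le_div_iff₀ (by positivity)]
    linarith
  have hr : (Module.finrank ℝ E : ℝ) < (m : ℝ) := by exact_mod_cast hm
  set I := ∫ v : E, (1 + ‖v‖) ^ (-(m : ℝ))
  refine ⟨2 ^ (m - 1) * (C * I + 2 ^ m * ((m + 1) * (C * I))), fun x ξ => ?_⟩
  have h0 := (φ.windowed f x).norm_pow_mul_norm_fourier_le 0 hr
    (fun j hj => hdec x j (hj.trans (Nat.zero_le m))) ξ
  have h1 := (φ.windowed f x).norm_pow_mul_norm_fourier_le m hr (hdec x) ξ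
  simp only [pow_zero, one_mul, CharP.cast_eq_zero, zero_add] at h0
  have h2 : (1 + ‖ξ‖) ^ m ≤ 2 ^ (m - 1) * (1 + ‖ξ‖ ^ m) := by
    simpa using add_pow_le zero_le_one (norm_nonneg ξ) m
  rw [← mul_assoc, Real.rpow_neg (by positivity : 0 ≤ 1 + ‖ξ‖), Real.rpow_natCast (1 + ‖ξ‖),
    ← div_eq_mul_inv, le_div_iff₀ (by positivity), mul_comm]
  calc _ ≤ 2 ^ (m - 1) * (1 + ‖ξ‖ ^ m) * ‖𝓕 (φ.windowed f x : E → ℂ) ξ‖ := by gcongr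
    _ = 2 ^ (m - 1) * (‖𝓕 (φ.windowed f x : E → ℂ) ξ‖ +
          ‖ξ‖ ^ m * ‖𝓕 (φ.windowed f x : E → ℂ) ξ‖) := by ring
    _ ≤ _ := mul_le_mul_of_nonneg_left (add_le_add h0 h1) (by positivity)
    _ = _ := by ring

end SchwartzDecay

lemma wavePacket_eq_fourier {n : ℕ} (φ f : 𝓢(EuclideanSpace ℝ (Fin n), ℂ))
    (x ξ : EuclideanSpace ℝ (Fin n)) :
    wavePacket φ f x ξ =
      𝓕 (φ.windowed f x : EuclideanSpace ℝ (Fin n) → ℂ) ((2 * π)⁻¹ • ξ) := by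
  rw [Real.fourier_eq', wavePacket]
  congr 1 with y
  have : -2 * π * ⟪y, (2 * π)⁻¹ • ξ⟫_ℝ = -⟪y, ξ⟫_ℝ := by
    rw [real_inner_smul_right]
    field_simp
  rw [this, SchwartzMap.windowed_apply, smul_eq_mul, mul_comm]
  congr 2
  push_cast
  ring

lemma measurable_wavePacket {n : ℕ} {φ f : EuclideanSpace ℝ (Fin n) → ℂ} (hφ : Continuous φ)
    (hf : Continuous f) :
    Measurable fun p : EuclideanSpace ℝ (Fin n) × EuclideanSpace ℝ (Fin n) =>
      wavePacket φ f p.1 p.2 := by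
  refine (StronglyMeasurable.integral_prod_right' (ν := volume)
    (f := fun q : (EuclideanSpace ℝ (Fin n) × EuclideanSpace ℝ (Fin n)) ×
      EuclideanSpace ℝ (Fin n) => (starRingEnd ℂ) (φ (q.2 - q.1.1)) * f q.2 *
        Complex.exp (-(Complex.I * (⟪q.2, q.1.2⟫_ℝ : ℂ)))) ?_).measurable
  refine Continuous.stronglyMeasurable ?_
  have : Continuous (starRingEnd ℂ) := Complex.continuous_conj
  fun_prop

lemma integrable_wavePacket {n : ℕ} (φ f : 𝓢(EuclideanSpace ℝ (Fin n), ℂ)) :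
    Integrable fun p : EuclideanSpace ℝ (Fin n) × EuclideanSpace ℝ (Fin n) =>
      wavePacket φ f p.1 p.2 := by
  obtain ⟨C, hC⟩ := φ.exists_norm_fourier_windowed_le f
    (Nat.lt_succ_self (Module.finrank ℝ (EuclideanSpace ℝ (Fin n))))
  have hI := integrable_one_add_norm (μ := (volume : Measure (EuclideanSpace ℝ (Fin n))))
    (show (Module.finrank ℝ (EuclideanSpace ℝ (Fin n)) : ℝ) <
      ((Module.finrank ℝ (EuclideanSpace ℝ (Fin n))).succ : ℕ) by
        exact_mod_cast Nat.lt_succ_self _)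
  have hR : (2 * π)⁻¹ ≠ 0 := by positivity
  refine ((hI.mul_prod (hI.comp_smul hR)).const_mul C).mono'
    (measurable_wavePacket φ.continuous f.continuous).aestronglyMeasurable (.of_forall fun p => ?_)
  rw [wavePacket_eq_fourier]
  exact hC _ _

section LIntegral

variable {α γ : Type*} [MeasurableSpace α] [MeasurableSpace γ]

lemma sq_lintegral_mul_le {ρ : Measure γ} {F G : γ → ℝ≥0∞} (hF : AEMeasurable F ρ)
    (hG : AEMeasurable G ρ) :
    (∫⁻ p, F p * G p ∂ρ) ^ 2 ≤ (∫⁻ p, F p ∂ρ) * ∫⁻ p, F p * G p ^ 2 ∂ρ := by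
  have sq (a : ℝ≥0∞) : (a ^ (1 / 2 : ℝ)) ^ 2 = a := by
    rw [← ENNReal.rpow_natCast, ← ENNReal.rpow_mul]
    norm_num
  have h := ENNReal.lintegral_mul_le_Lp_mul_Lq ρ Real.HolderConjugate.two_two
    (hF.pow_const (1 / 2 : ℝ)) ((hF.pow_const (1 / 2 : ℝ)).mul hG)
  simp only [Pi.mul_apply, ENNReal.rpow_ofNat, mul_pow, sq] at h
  calc (∫⁻ p, F p * G p ∂ρ) ^ 2
      = (∫⁻ p, F p ^ (1 / 2 : ℝ) * (F p ^ (1 / 2 : ℝ) * G p) ∂ρ) ^ 2 := by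
        simp only [← mul_assoc, ← pow_two, sq]
    _ ≤ _ := pow_le_pow_left' h 2
    _ = _ := by rw [mul_pow, sq, sq]

/-- A squared form of Minkowski's integral inequality for a weighted average of functions with
uniformly bounded `L²` norms. -/
lemma lintegral_sq_lintegral_mul_le {μ : Measure α} {ρ : Measure γ} [SFinite μ] [SFinite ρ]
    {F : γ → ℝ≥0∞} {G : α → γ → ℝ≥0∞} (hF : Measurable F)
    (hG : Measurable (Function.uncurry G)) {R : ℝ≥0∞}
    (hR : ∀ᵐ p ∂ρ, ∫⁻ x, G x p ^ 2 ∂μ ≤ R) :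
    ∫⁻ x, (∫⁻ p, F p * G x p ∂ρ) ^ 2 ∂μ ≤ (∫⁻ p, F p ∂ρ) ^ 2 * R := by
  have hG' : Measurable fun q : α × γ => F q.2 * G q.1 q.2 ^ 2 :=
    (hF.comp measurable_snd).mul (hG.pow_const 2)
  calc _ ≤ ∫⁻ x, (∫⁻ p, F p ∂ρ) * ∫⁻ p, F p * G x p ^ 2 ∂ρ ∂μ :=
        lintegral_mono fun x => sq_lintegral_mul_le hF.aemeasurable
          (hG.comp measurable_prodMk_left).aemeasurable
    _ = (∫⁻ p, F p ∂ρ) * ∫⁻ p, F p * ∫⁻ x, G x p ^ 2 ∂μ ∂ρ := by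
        rw [lintegral_const_mul _ hG'.lintegral_prod_right',
          lintegral_lintegral_swap hG'.aemeasurable]
        congr 2 with p
        exact lintegral_const_mul (F p)
          (f := fun x => G x p ^ 2) ((hG.comp measurable_prodMk_right).pow_const 2)
    _ ≤ (∫⁻ p, F p ∂ρ) * ∫⁻ p, F p * R ∂ρ := by
        gcongr 1
        refine lintegral_mono_ae (hR.mono fun p hp => ?_)
        gcongr
    _ = _ := by rw [lintegral_mul_const _ hF, pow_two, mul_assoc]

lemma setLIntegral_comp_sub_le {E : Type*} [MeasurableSpace E] [AddGroup E] [MeasurableAdd E]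
    {μ : Measure E} [μ.IsAddRightInvariant] {s t : Set E} (hs : MeasurableSet s)
    (ht : MeasurableSet t) {a : E} (hst : ∀ x ∈ s, x - a ∈ t) (f : E → ℝ≥0∞) :
    ∫⁻ x in s, f (x - a) ∂μ ≤ ∫⁻ x in t, f x ∂μ := by
  rw [← lintegral_indicator hs, ← lintegral_indicator ht,
    ← lintegral_sub_right_eq_self (t.indicator f) a]
  refine lintegral_mono fun x => ?_
  by_cases hx : x ∈ s
  · simp [hx, hst x hx]
  · simp [hx]

/-- The anisotropic dilation `(w, η) ↦ (r w, r⁻¹ η)` preserves the integral. -/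
lemma lintegral_comp_smul_inv_smul {E : Type*} [NormedAddCommGroup E] [NormedSpace ℝ E]
    [FiniteDimensional ℝ E] [MeasurableSpace E] [BorelSpace E] {μ : Measure E}
    [μ.IsAddHaarMeasure] {r : ℝ} (hr : r ≠ 0) {f : E × E → ℝ≥0∞} (hf : Measurable f) :
    ∫⁻ p, f (r • p.1, r⁻¹ • p.2) ∂(μ.prod μ) = ∫⁻ p, f p ∂(μ.prod μ) := by
  have hmap : Measure.map (Prod.map (r • ·) (r⁻¹ • ·)) (μ.prod μ) = μ.prod μ := by
    rw [← Measure.map_prod_map μ μ (measurable_const_smul r) (measurable_const_smul r⁻¹),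
      Measure.map_addHaar_smul μ hr, Measure.map_addHaar_smul μ (inv_ne_zero hr),
      Measure.prod_smul_left, Measure.prod_smul_right, smul_smul,
      ← ENNReal.ofReal_mul (abs_nonneg _), ← abs_mul]
    have : (r ^ Module.finrank ℝ E)⁻¹ * (r⁻¹ ^ Module.finrank ℝ E)⁻¹ = 1 := by
      rw [inv_pow, inv_inv, inv_mul_cancel₀ (pow_ne_zero _ hr)]
    rw [this, abs_one, ENNReal.ofReal_one, one_smul]
  conv_rhs => rw [← hmap, lintegral_map hf (by fun_prop)]
  rfl

end LIntegral

/-- For `0 < b < 1/2`, compact sets `K, V` and open sets `K̃ ⊇ K`, `Ṽ ⊇ V`,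
there is `λ₀ ≥ 1` such that for every measurable `h : ℝ²ⁿ → [0,∞]`, every `λ ≥ λ₀` and `c ∈ ℝ`,
the contribution of the region `|w| ≤ λ^{-b/2}, |η| ≤ λ^{3b/2}` to the convolution is controlled
by the norm of `h (x + cλξ, λξ)` over the enlarged sets:
`‖∬_{|w|≤λ^{-b/2}, |η|≤λ^{3b/2}} |W_Φ Φ (λ^b w, λ^{-b}η)| h (x-w+c(λξ-η), λξ-η) dw dη‖_{L²_x(K)×L²_ξ(V)}
  ≤ ‖W_Φ Φ‖_{L¹(ℝ²ⁿ)} ‖h (x + cλξ, λξ)‖_{L²_x(K̃)×L²_ξ(Ṽ)}`. -/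
theorem wavePacket_region_D2_estimate (n : ℕ) (hn : 1 ≤ n) (b : ℝ) (hb0 : 0 < b)
    (hb1 : b < 1 / 2) (Φ : SchwartzMap (EuclideanSpace ℝ (Fin n)) ℂ) (hΦ : Φ ≠ 0)
    (K V Kt Vt : Set (EuclideanSpace ℝ (Fin n)))
    (hK : IsCompact K) (hV : IsCompact V) (hKt : IsOpen Kt) (hVt : IsOpen Vt)
    (hKKt : K ⊆ Kt) (hVVt : V ⊆ Vt) :
    ∃ l₀ : ℝ, 1 ≤ l₀ ∧
      ∀ h : EuclideanSpace ℝ (Fin n) × EuclideanSpace ℝ (Fin n) → ℝ≥0∞, Measurable h →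
        ∀ l : ℝ, l₀ ≤ l → ∀ c : ℝ,
          (∫⁻ x in K, ∫⁻ ξ in V,
              (∫⁻ p in {p : EuclideanSpace ℝ (Fin n) × EuclideanSpace ℝ (Fin n) |
                    ‖p.1‖ ≤ l ^ (-b / 2) ∧ ‖p.2‖ ≤ l ^ (3 * b / 2)},
                  ENNReal.ofReal ‖wavePacket (⇑Φ) (⇑Φ) ((l ^ b) • p.1) ((l ^ (-b)) • p.2)‖ *
                    h (x - p.1 + c • (l • ξ - p.2), l • ξ - p.2)) ^ 2) ^ ((1 : ℝ) / 2)
            ≤ ENNReal.ofReal (∫ p : EuclideanSpace ℝ (Fin n) × EuclideanSpace ℝ (Fin n),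
                  ‖wavePacket (⇑Φ) (⇑Φ) p.1 p.2‖) *
                (∫⁻ x in Kt, ∫⁻ ξ in Vt, (h (x + (c * l) • ξ, l • ξ)) ^ 2) ^ ((1 : ℝ) / 2) := by
  obtain ⟨δ, hδ, hδK⟩ := hK.exists_cthickening_subset_open hKt hKKt
  obtain ⟨ε, hε, hεV⟩ := hV.exists_cthickening_subset_open hVt hVVt
  obtain ⟨l₀, hl₀⟩ := Filter.eventually_atTop.1 <|
    ((tendsto_rpow_neg_atTop (half_pos hb0)).eventually_le_const hδ).and
    ((tendsto_rpow_neg_atTop (show 0 < 1 - 3 * b / 2 by linarith)).eventually_le_const hε)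
  refine ⟨max 1 l₀, le_max_left _ _, fun h hh l hl c => ?_⟩
  have hl0 : 0 < l := one_pos.trans_le ((le_max_left _ _).trans hl)
  obtain ⟨hlδ, hlε⟩ := hl₀ l ((le_max_right _ _).trans hl)
  set W := fun p : EuclideanSpace ℝ (Fin n) × EuclideanSpace ℝ (Fin n) =>
    ENNReal.ofReal ‖wavePacket (⇑Φ) (⇑Φ) p.1 p.2‖
  have hW : Measurable W :=
    (measurable_wavePacket Φ.continuous Φ.continuous).norm.ennreal_ofReal
  set D := {p : EuclideanSpace ℝ (Fin n) × EuclideanSpace ℝ (Fin n) |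
    ‖p.1‖ ≤ l ^ (-b / 2) ∧ ‖p.2‖ ≤ l ^ (3 * b / 2)}
  have hD : MeasurableSet D :=
    (measurableSet_le measurable_fst.norm measurable_const).inter
      (measurableSet_le measurable_snd.norm measurable_const)
  set F := fun p : EuclideanSpace ℝ (Fin n) × EuclideanSpace ℝ (Fin n) =>
    W ((l ^ b) • p.1, (l ^ (-b)) • p.2) with hFdef
  have hF : Measurable F := hW.comp (by fun_prop)
  set G := fun (q p : EuclideanSpace ℝ (Fin n) × EuclideanSpace ℝ (Fin n)) =>
    h (q.1 - p.1 + c • (l • q.2 - p.2), l • q.2 - p.2)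
  have hG : Measurable (Function.uncurry G) := hh.comp (by fun_prop)
  set R := ∫⁻ x in Kt, ∫⁻ ξ in Vt, (h (x + (c * l) • ξ, l • ξ)) ^ 2
  have hFint : ∫⁻ p in D, F p ≤ ∫⁻ p, W p := by
    refine (setLIntegral_le_lintegral _ _).trans_eq ?_
    have hb : l ^ b ≠ 0 := (rpow_pos_of_pos hl0 b).ne'
    simp only [hFdef, rpow_neg hl0.le]
    exact lintegral_comp_smul_inv_smul hb hW
  have hGint : ∀ p ∈ D, ∫⁻ q in K ×ˢ V, G q p ^ 2 ≤ R := by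
    rintro ⟨w, η⟩ ⟨hw, hη⟩
    have hKw : ∀ x ∈ K, x - w ∈ Kt := fun x hx => hδK <| by
      refine Metric.mem_cthickening_of_dist_le _ x _ _ hx ?_
      rw [dist_eq_norm, sub_sub_cancel_left, norm_neg]
      exact hw.trans (by simpa [neg_div] using hlδ)
    have hVη : ∀ ξ ∈ V, ξ - l⁻¹ • η ∈ Vt := fun ξ hξ => hεV <| by
      refine Metric.mem_cthickening_of_dist_le _ ξ _ _ hξ ?_
      rw [dist_eq_norm, sub_sub_cancel_left, norm_neg, norm_smul, norm_inv, Real.norm_eq_abs,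
        abs_of_pos hl0]
      calc l⁻¹ * ‖η‖ ≤ l⁻¹ * l ^ (3 * b / 2) := by gcongr
        _ = l ^ (-(1 - 3 * b / 2)) := by
            rw [← rpow_neg_one, ← rpow_add hl0]
            ring_nf
        _ ≤ ε := hlε
    have hsub (x ξ : EuclideanSpace ℝ (Fin n)) : G (x, ξ) (w, η) =
        h ((x - w) + (c * l) • (ξ - l⁻¹ • η), l • (ξ - l⁻¹ • η)) := by
      have : l • (ξ - l⁻¹ • η) = l • ξ - η := by
        rw [smul_sub, smul_inv_smul₀ hl0.ne']
      rw [mul_smul, this]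
    rw [Measure.volume_eq_prod, ← Measure.prod_restrict,
      lintegral_prod (fun q => G q (w, η) ^ 2)
        ((hG.comp measurable_prodMk_right).pow_const 2).aemeasurable]
    simp only [hsub]
    calc _ ≤ ∫⁻ x in K, ∫⁻ ξ in Vt, h ((x - w) + (c * l) • ξ, l • ξ) ^ 2 :=
          lintegral_mono fun x => setLIntegral_comp_sub_le hV.measurableSet hVt.measurableSet hVη
            fun ξ => h ((x - w) + (c * l) • ξ, l • ξ) ^ 2
      _ ≤ R := setLIntegral_comp_sub_le hK.measurableSet hKt.measurableSet hKw
            fun x => ∫⁻ ξ in Vt, h (x + (c * l) • ξ, l • ξ) ^ 2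
  have hmeas : Measurable fun q => (∫⁻ p in D, F p * G q p) ^ 2 :=
    (((hF.comp measurable_snd).mul hG).lintegral_prod_right').pow_const 2
  have hmain : ∫⁻ x in K, ∫⁻ ξ in V, (∫⁻ p in D, F p * G (x, ξ) p) ^ 2 ≤
      (∫⁻ p, W p) ^ 2 * R := by
    rw [lintegral_lintegral (f := fun x ξ => (∫⁻ p in D, F p * G (x, ξ) p) ^ 2)
      hmeas.aemeasurable, Measure.prod_restrict, ← Measure.volume_eq_prod]
    calc _ ≤ (∫⁻ p in D, F p) ^ 2 * R :=
          lintegral_sq_lintegral_mul_le hF hG (ae_restrict_of_forall_mem hD hGint)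
      _ ≤ _ := by gcongr
  rw [ofReal_integral_eq_lintegral_ofReal (integrable_wavePacket Φ Φ).norm
    (.of_forall fun _ => norm_nonneg _)]
  calc _ ≤ ((∫⁻ p, W p) ^ 2 * R) ^ ((1 : ℝ) / 2) := ENNReal.rpow_le_rpow hmain (by norm_num)
    _ = (∫⁻ p, W p) * R ^ ((1 : ℝ) / 2) := by
      rw [ENNReal.mul_rpow_of_nonneg _ _ (by norm_num), ← ENNReal.rpow_natCast,
        ← ENNReal.rpow_mul]
      norm_num
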